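/- arXiv:math/0601734 — 2 statements merged into one kernel-verified Lean document; each statement's English description precedes it below -/
import Mathlib

section
/- Let k be an algebraically closed field and F a 5-dimensional k-vector space. Say that a pair (ω₁,ω₂) of alternating bilinear forms on F satisfies the two conditions if each ωᵢ has rank 4, ker ω₁ ∩ ker ω₂ = {0}, and L_{ω₂}(ker ω₁) ∩ L_{ω₁}(ker ω₂) = {0} in F*. If (ω₁,ω₂) satisfies the two conditions, then U(ω₁,ω₂) := l(ω₁,ω₂) ∩ l(ω₂,ω₁) is 3-dimensional and both ω₁ and ω₂ vanish identically on it. Moreover, if ω₁', ω₂' are k-linear combinations of ω₁, ω₂ such that the pair (ω₁',ω₂') also satisfies the two conditions, then U(ω₁',ω₂') = U(ω₁,ω₂). -/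
open Module

/-- For alternating forms ω₁, ω₂ on F, the subspace
`l(ω₁,ω₂) := {f ∈ F : ω₂(u,f) = 0 for all u ∈ ker ω₁}`. -/
def lSub {k F : Type*} [Field k] [AddCommGroup F] [Module k F]
    (ω₁ ω₂ : F →ₗ[k] F →ₗ[k] k) : Submodule k F where
  carrier := {f | ∀ u ∈ LinearMap.ker ω₁, ω₂ u f = 0}
  add_mem' := by
    intro a b ha hb u hu
    simp [map_add, ha u hu, hb u hu]
  zero_mem' := by
    intro u hu
    simp
  smul_mem' := by
    intro c a ha u hu
    simp [map_smul, ha u hu]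

/-- `U(ω₁,ω₂) := l(ω₁,ω₂) ∩ l(ω₂,ω₁)`. -/
def Uof {k F : Type*} [Field k] [AddCommGroup F] [Module k F]
    (ω₁ ω₂ : F →ₗ[k] F →ₗ[k] k) : Submodule k F :=
  lSub ω₁ ω₂ ⊓ lSub ω₂ ω₁

/-- The pair (ω₁,ω₂) of (alternating) bilinear forms on F satisfies "the two conditions":
each ωᵢ has rank 4, ker ω₁ ∩ ker ω₂ = {0}, and L_{ω₂}(ker ω₁) ∩ L_{ω₁}(ker ω₂) = {0} in F*. -/
def TwoConditions {k F : Type*} [Field k] [AddCommGroup F] [Module k F]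
    (ω₁ ω₂ : F →ₗ[k] F →ₗ[k] k) : Prop :=
  finrank k (LinearMap.range ω₁) = 4 ∧ finrank k (LinearMap.range ω₂) = 4 ∧
    LinearMap.ker ω₁ ⊓ LinearMap.ker ω₂ = ⊥ ∧
    (LinearMap.ker ω₁).map ω₂ ⊓ (LinearMap.ker ω₂).map ω₁ = ⊥

theorem lSub_eq_dualCoannihilator {k F : Type*} [Field k] [AddCommGroup F] [Module k F]
    (ω₁ ω₂ : F →ₗ[k] F →ₗ[k] k) :
    lSub ω₁ ω₂ = ((LinearMap.ker ω₁).map ω₂).dualCoannihilator := by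
  ext f
  simp [lSub, Submodule.mem_dualCoannihilator]

theorem finrank_add_finrank_ker_ge {k F : Type*} [Field k] [AddCommGroup F] [Module k F]
    [FiniteDimensional k F] {V : Type*} [AddCommGroup V] [Module k V]
    (f : F →ₗ[k] V) (W : Submodule k F) :
    finrank k W ≤ finrank k (W.map f) + finrank k (W ⊓ LinearMap.ker f : Submodule k F) := by
  have h := LinearMap.finrank_range_add_finrank_ker (f.domRestrict W)
  rw [LinearMap.range_domRestrict, LinearMap.ker_domRestrict,
    (Submodule.equivSubtypeMap W _).finrank_eq, Submodule.map_comap_subtype] at h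
  exact h.ge

theorem finrank_ker_eq_one_of_finrank_range {k F V : Type*} [Field k] [AddCommGroup F]
    [Module k F] [FiniteDimensional k F] [AddCommGroup V] [Module k V]
    (hdim : finrank k F = 5) {f : F →ₗ[k] V} (hf : finrank k (LinearMap.range f) = 4) :
    finrank k (LinearMap.ker f) = 1 := by
  have := f.finrank_range_add_finrank_ker
  omega

theorem finrank_Uof {k F : Type*} [Field k] [AddCommGroup F] [Module k F]
    [FiniteDimensional k F] (hdim : finrank k F = 5) {ω₁ ω₂ : F →ₗ[k] F →ₗ[k] k}
    (h : TwoConditions ω₁ ω₂) : finrank k (Uof ω₁ ω₂) = 3 := by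
  obtain ⟨h₁, h₂, hker, hmap⟩ := h
  have e₁ := finrank_ker_eq_one_of_finrank_range hdim h₁
  have e₂ := finrank_ker_eq_one_of_finrank_range hdim h₂
  have m₁ := finrank_add_finrank_ker_ge ω₂ (LinearMap.ker ω₁)
  have m₂ := finrank_add_finrank_ker_ge ω₁ (LinearMap.ker ω₂)
  rw [hker, finrank_bot] at m₁
  rw [inf_comm, hker, finrank_bot] at m₂
  have l₁ := Submodule.finrank_map_le ω₂ (LinearMap.ker ω₁)
  have l₂ := Submodule.finrank_map_le ω₁ (LinearMap.ker ω₂)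
  have hs := Submodule.finrank_sup_add_finrank_inf_eq
    ((LinearMap.ker ω₁).map ω₂) ((LinearMap.ker ω₂).map ω₁)
  rw [hmap, finrank_bot] at hs
  have hU : Uof ω₁ ω₂ =
      ((LinearMap.ker ω₁).map ω₂ ⊔ (LinearMap.ker ω₂).map ω₁).dualCoannihilator := by
    rw [Uof, lSub_eq_dualCoannihilator, lSub_eq_dualCoannihilator,
      Submodule.dualCoannihilator_sup_eq]
  have hd : finrank k ((LinearMap.ker ω₁).map ω₂ ⊔ (LinearMap.ker ω₂).map ω₁ :
      Submodule k (F →ₗ[k] k)) + finrank k (Uof ω₁ ω₂) = finrank k F := by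
    rw [hU]
    exact Subspace.finrank_add_finrank_dualCoannihilator_eq _
  omega

/-- An alternating form whose radical on `U` contains a subspace of codimension at most one
vanishes on `U`. -/
theorem isotropic_of_finrank_le_add_one {k F : Type*} [Field k] [AddCommGroup F] [Module k F]
    [FiniteDimensional k F] {ω : F →ₗ[k] F →ₗ[k] k} (halt : ω.IsAlt) {K U : Submodule k F}
    (hKU : K ≤ U) (hfin : finrank k U ≤ finrank k K + 1)
    (hK : ∀ x ∈ K, ∀ u ∈ U, ω x u = 0) : ∀ u ∈ U, ∀ v ∈ U, ω u v = 0 := by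
  intro u hu v hv
  by_cases huK : u ∈ K
  · exact hK u huK v hv
  have hlt : K < K ⊔ k ∙ u := by
    refine lt_of_le_of_ne le_sup_left fun h => huK ?_
    rw [h]
    exact Submodule.mem_sup_right (Submodule.mem_span_singleton_self u)
  have hle : K ⊔ k ∙ u ≤ U := sup_le hKU ((Submodule.span_singleton_le_iff_mem u U).2 hu)
  have heq : K ⊔ k ∙ u = U :=
    Submodule.eq_of_le_of_finrank_le hle (hfin.trans (Submodule.finrank_lt_finrank_of_lt hlt))
  rw [← heq] at hv
  obtain ⟨x, hx, y, hy, rfl⟩ := Submodule.mem_sup.1 hv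
  obtain ⟨c, rfl⟩ := Submodule.mem_span_singleton.1 hy
  rw [map_add, map_smul, halt u, ← halt.neg, hK x hx u hu]
  simp

theorem two_mul_finrank_le_of_isotropic {k F : Type*} [Field k] [AddCommGroup F] [Module k F]
    [FiniteDimensional k F] {ω : F →ₗ[k] F →ₗ[k] k} {W : Submodule k F}
    (hW : ∀ u ∈ W, ∀ v ∈ W, ω u v = 0) :
    2 * finrank k W ≤ finrank k F + finrank k (LinearMap.ker ω) := by
  have h := finrank_add_finrank_ker_ge ω W
  have hle : W.map ω ≤ W.dualAnnihilator := by
    rintro _ ⟨u, hu, rfl⟩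
    exact (Submodule.mem_dualAnnihilator _).2 (hW u hu)
  have h₁ : finrank k (W.map ω) ≤ finrank k W.dualAnnihilator := Submodule.finrank_mono hle
  have h₂ : finrank k (W ⊓ LinearMap.ker ω : Submodule k F) ≤ finrank k (LinearMap.ker ω) :=
    Submodule.finrank_mono inf_le_right
  have h₃ : finrank k W + finrank k W.dualAnnihilator = finrank k F :=
    Subspace.finrank_add_finrank_dualAnnihilator_eq W
  omega

/-- The radical of an alternating form is contained in every isotropic subspace of
maximal possible dimension. -/
theorem ker_le_of_isotropic {k F : Type*} [Field k] [AddCommGroup F] [Module k F]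
    [FiniteDimensional k F] {ω : F →ₗ[k] F →ₗ[k] k} (halt : ω.IsAlt) {U : Submodule k F}
    (hU : ∀ u ∈ U, ∀ v ∈ U, ω u v = 0)
    (hfin : finrank k F + finrank k (LinearMap.ker ω) ≤ 2 * finrank k U) :
    LinearMap.ker ω ≤ U := by
  have hW : ∀ u ∈ U ⊔ LinearMap.ker ω, ∀ v ∈ U ⊔ LinearMap.ker ω, ω u v = 0 := by
    intro u hu v hv
    obtain ⟨a, ha, x, hx, rfl⟩ := Submodule.mem_sup.1 hu
    obtain ⟨b, hb, y, hy, rfl⟩ := Submodule.mem_sup.1 hv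
    rw [LinearMap.mem_ker] at hx hy
    have hay : ω a y = 0 := by rw [← halt.neg, hy]; simp
    simp [hx, hay, hU a ha b hb]
  have h := two_mul_finrank_le_of_isotropic hW
  have heq : U = U ⊔ LinearMap.ker ω :=
    Submodule.eq_of_le_of_finrank_le le_sup_left (by omega)
  rw [heq]
  exact le_sup_right

theorem Uof_comm {k F : Type*} [Field k] [AddCommGroup F] [Module k F]
    (ω₁ ω₂ : F →ₗ[k] F →ₗ[k] k) : Uof ω₁ ω₂ = Uof ω₂ ω₁ :=
  inf_comm _ _

theorem TwoConditions.symm {k F : Type*} [Field k] [AddCommGroup F] [Module k F]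
    {ω₁ ω₂ : F →ₗ[k] F →ₗ[k] k} (h : TwoConditions ω₁ ω₂) : TwoConditions ω₂ ω₁ :=
  ⟨h.2.1, h.1, (inf_comm _ _).trans h.2.2.1, (inf_comm _ _).trans h.2.2.2⟩

theorem ker_left_le_Uof {k F : Type*} [Field k] [AddCommGroup F] [Module k F]
    {ω₁ ω₂ : F →ₗ[k] F →ₗ[k] k} (halt₁ : ω₁.IsAlt) (halt₂ : ω₂.IsAlt)
    (h : finrank k (LinearMap.ker ω₁) = 1) : LinearMap.ker ω₁ ≤ Uof ω₁ ω₂ := by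
  intro x hx
  refine ⟨fun u hu => ?_, fun u _ => ?_⟩
  · by_cases hx0 : x = 0
    · simp [hx0]
    · obtain ⟨c, hc⟩ := (finrank_eq_one_iff_of_nonzero' (⟨x, hx⟩ : LinearMap.ker ω₁)
        (by simpa using hx0)).1 h ⟨u, hu⟩
      have hcx : c • x = u := congrArg Subtype.val hc
      simp [← hcx, halt₂ x]
  · rw [← halt₁.neg, LinearMap.mem_ker.1 hx]
    simp

theorem isotropic_left_Uof {k F : Type*} [Field k] [AddCommGroup F] [Module k F]
    [FiniteDimensional k F] (hdim : finrank k F = 5) {ω₁ ω₂ : F →ₗ[k] F →ₗ[k] k}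
    (halt₁ : ω₁.IsAlt) (halt₂ : ω₂.IsAlt) (h : TwoConditions ω₁ ω₂) :
    ∀ u ∈ Uof ω₁ ω₂, ∀ v ∈ Uof ω₁ ω₂, ω₁ u v = 0 := by
  have e₁ := finrank_ker_eq_one_of_finrank_range hdim h.1
  have e₂ := finrank_ker_eq_one_of_finrank_range hdim h.2.1
  have hs := Submodule.finrank_sup_add_finrank_inf_eq (LinearMap.ker ω₁) (LinearMap.ker ω₂)
  rw [h.2.2.1, finrank_bot] at hs
  have hU := finrank_Uof hdim h
  refine isotropic_of_finrank_le_add_one halt₁ (K := LinearMap.ker ω₁ ⊔ LinearMap.ker ω₂)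
    (sup_le (ker_left_le_Uof halt₁ halt₂ e₁) ?_) (by omega) ?_
  · rw [Uof_comm]
    exact ker_left_le_Uof halt₂ halt₁ e₂
  · intro x hx u hu
    obtain ⟨y, hy, z, hz, rfl⟩ := Submodule.mem_sup.1 hx
    have hzu : ω₁ z u = 0 := hu.2 z hz
    simp [LinearMap.mem_ker.1 hy, hzu]

/-- Let k be an algebraically closed field and F a 5-dimensional k-vector space.
If the pair (ω₁,ω₂) of alternating bilinear forms satisfies the two conditions, then
U(ω₁,ω₂) := l(ω₁,ω₂) ∩ l(ω₂,ω₁) is 3-dimensional and both ω₁ and ω₂ vanish identically on it.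
Moreover, if ω₁', ω₂' are k-linear combinations of ω₁, ω₂ such that the pair (ω₁',ω₂') also
satisfies the two conditions, then U(ω₁',ω₂') = U(ω₁,ω₂). -/
theorem Uof_isotropic_and_invariant
    (k : Type*) [Field k] [IsAlgClosed k]
    (F : Type*) [AddCommGroup F] [Module k F] [FiniteDimensional k F]
    (hdim : finrank k F = 5)
    (ω₁ ω₂ : F →ₗ[k] F →ₗ[k] k)
    (halt₁ : ∀ x, ω₁ x x = 0) (halt₂ : ∀ x, ω₂ x x = 0)
    (hcond : TwoConditions ω₁ ω₂) :
    finrank k (Uof ω₁ ω₂) = 3 ∧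
    (∀ u ∈ Uof ω₁ ω₂, ∀ v ∈ Uof ω₁ ω₂, ω₁ u v = 0) ∧
    (∀ u ∈ Uof ω₁ ω₂, ∀ v ∈ Uof ω₁ ω₂, ω₂ u v = 0) ∧
    (∀ a b c d : k,
      TwoConditions (a • ω₁ + b • ω₂) (c • ω₁ + d • ω₂) →
      Uof (a • ω₁ + b • ω₂) (c • ω₁ + d • ω₂) = Uof ω₁ ω₂) := by
  have hdim₃ := finrank_Uof hdim hcond
  have iso₁ := isotropic_left_Uof hdim halt₁ halt₂ hcond
  have iso₂ := isotropic_left_Uof hdim halt₂ halt₁ hcond.symm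
  rw [Uof_comm] at iso₂
  refine ⟨hdim₃, iso₁, iso₂, fun a b c d h => ?_⟩
  have iso (s t : k) : ∀ u ∈ Uof ω₁ ω₂, ∀ v ∈ Uof ω₁ ω₂, (s • ω₁ + t • ω₂) u v = 0 := by
    intro u hu v hv
    simp [iso₁ u hu v hv, iso₂ u hu v hv]
  have hker (s t : k) (hr : finrank k (LinearMap.range (s • ω₁ + t • ω₂)) = 4) :
      LinearMap.ker (s • ω₁ + t • ω₂) ≤ Uof ω₁ ω₂ := by
    have := finrank_ker_eq_one_of_finrank_range hdim hr
    exact ker_le_of_isotropic (fun x => by simp [halt₁ x, halt₂ x]) (iso s t) (by omega)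
  have hle : Uof ω₁ ω₂ ≤ Uof (a • ω₁ + b • ω₂) (c • ω₁ + d • ω₂) := by
    refine fun x hx => ⟨fun u hu => ?_, fun u hu => ?_⟩
    · exact iso c d u (hker a b h.1 hu) x hx
    · exact iso a b u (hker c d h.2.1 hu) x hx
  exact (Submodule.eq_of_le_of_finrank_le hle (by rw [hdim₃, finrank_Uof hdim h])).symm
end

section
/- Let k be a field, F a 5-dimensional k-vector space with basis (f₁,…,f₅) and dual basis (f₁*,…,f₅*), and set ω₁ = f₂*∧f₄* + f₃*∧f₅* and ω₂ = f₁*∧f₅* + f₃*∧f₄*. Let O be the orbit of the pair (ω₁,ω₂) under the action of GL₂(k) × GL(F) on pairs of alternating bilinear forms on F. Suppose u assigns to every pair p ∈ O a 3-dimensional linear subspace u(p) ⊆ F, equivariantly: u((A,g)·p) = g(u(p)) for all (A,g) ∈ GL₂(k) × GL(F) and p ∈ O. Then for every p = (p₁,p₂) ∈ O one has u(p) = l(p₁,p₂) ∩ l(p₂,p₁). -/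
open Module

/-- For linear functionals φ, ψ on F, the alternating bilinear form
`φ∧ψ : (x,y) ↦ φ(x)ψ(y) − ψ(x)φ(y)`. -/
def wedge {k F : Type*} [Field k] [AddCommGroup F] [Module k F]
    (φ ψ : F →ₗ[k] k) : F →ₗ[k] F →ₗ[k] k :=
  LinearMap.mk₂ k (fun x y => φ x * ψ y - ψ x * φ y)
    (fun x x' y => by simp [map_add]; ring)
    (fun c x y => by simp [map_smul, smul_eq_mul]; ring)
    (fun x y y' => by simp [map_add]; ring)
    (fun c x y => by simp [map_smul, smul_eq_mul]; ring)

/-- The pullback `η^g` of a bilinear form η along g⁻¹ : `η^g(x,y) = η(g⁻¹x, g⁻¹y)`. -/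
def pullbackForm {k F : Type*} [Field k] [AddCommGroup F] [Module k F]
    (η : F →ₗ[k] F →ₗ[k] k) (g : F ≃ₗ[k] F) : F →ₗ[k] F →ₗ[k] k :=
  η.compl₁₂ g.symm.toLinearMap g.symm.toLinearMap

/-- The action of `(A, g) ∈ GL₂(k) × GL(F)` on pairs of bilinear forms:
`(A,g)·(η₁,η₂) = (a·η₁^g + b·η₂^g, c·η₁^g + d·η₂^g)` where `A = [[a,b],[c,d]]`. -/
def actPair {k F : Type*} [Field k] [AddCommGroup F] [Module k F]
    (A : Matrix (Fin 2) (Fin 2) k) (g : F ≃ₗ[k] F)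
    (p : (F →ₗ[k] F →ₗ[k] k) × (F →ₗ[k] F →ₗ[k] k)) :
    (F →ₗ[k] F →ₗ[k] k) × (F →ₗ[k] F →ₗ[k] k) :=
  (A 0 0 • pullbackForm p.1 g + A 0 1 • pullbackForm p.2 g,
   A 1 0 • pullbackForm p.1 g + A 1 1 • pullbackForm p.2 g)

section NormalForm

variable {k F : Type*} [Field k] [AddCommGroup F] [Module k F]

@[simp]
theorem wedge_apply (φ ψ : F →ₗ[k] k) (x y : F) :
    wedge φ ψ x y = φ x * ψ y - ψ x * φ y := rfl

@[simp]
theorem pullbackForm_apply (η : F →ₗ[k] F →ₗ[k] k) (g : F ≃ₗ[k] F) (x y : F) :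
    pullbackForm η g x y = η (g.symm x) (g.symm y) := rfl

theorem mem_lSub {ω₁ ω₂ : F →ₗ[k] F →ₗ[k] k} {f : F} :
    f ∈ lSub ω₁ ω₂ ↔ ∀ u, ω₁ u = 0 → ω₂ u f = 0 := Iff.rfl

theorem pullbackForm_smul_add_smul (a b : k) (η₁ η₂ : F →ₗ[k] F →ₗ[k] k) (g : F ≃ₗ[k] F) :
    a • pullbackForm η₁ g + b • pullbackForm η₂ g = pullbackForm (a • η₁ + b • η₂) g := rfl

theorem pullbackForm_apply_eq_zero {η : F →ₗ[k] F →ₗ[k] k} {g : F ≃ₗ[k] F} {x : F} :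
    pullbackForm η g x = 0 ↔ η (g.symm x) = 0 := by
  constructor
  · intro h
    ext y
    simpa using LinearMap.congr_fun h (g y)
  · intro h
    ext y
    simp [h]

theorem lSub_pullbackForm (η₁ η₂ : F →ₗ[k] F →ₗ[k] k) (g : F ≃ₗ[k] F) :
    lSub (pullbackForm η₁ g) (pullbackForm η₂ g) = (lSub η₁ η₂).map g.toLinearMap := by
  ext f
  rw [Submodule.mem_map_equiv, mem_lSub, mem_lSub]
  simp only [pullbackForm_apply_eq_zero, pullbackForm_apply]
  exact ⟨fun h u hu => by simpa using h (g u) (by simpa using hu), fun h u hu => h _ hu⟩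

/-- The first form `f₂*∧f₄* + f₃*∧f₅*` of the normal form attached to a basis. -/
noncomputable def normalForm₁ (B : Basis (Fin 5) k F) : F →ₗ[k] F →ₗ[k] k :=
  wedge (B.coord 1) (B.coord 3) + wedge (B.coord 2) (B.coord 4)

/-- The second form `f₁*∧f₅* + f₃*∧f₄*` of the normal form attached to a basis. -/
noncomputable def normalForm₂ (B : Basis (Fin 5) k F) : F →ₗ[k] F →ₗ[k] k :=
  wedge (B.coord 0) (B.coord 4) + wedge (B.coord 2) (B.coord 3)

/-- The span of the first three vectors of a basis, as a common kernel of the other two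
coordinates. -/
noncomputable def spanFirstThree (B : Basis (Fin 5) k F) : Submodule k F :=
  LinearMap.ker (B.coord 3) ⊓ LinearMap.ker (B.coord 4)

variable (B : Basis (Fin 5) k F)

theorem normalForm₁_apply (x y : F) :
    normalForm₁ B x y = B.repr x 1 * B.repr y 3 - B.repr x 3 * B.repr y 1
      + (B.repr x 2 * B.repr y 4 - B.repr x 4 * B.repr y 2) := rfl

theorem normalForm₂_apply (x y : F) :
    normalForm₂ B x y = B.repr x 0 * B.repr y 4 - B.repr x 4 * B.repr y 0
      + (B.repr x 2 * B.repr y 3 - B.repr x 3 * B.repr y 2) := rfl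

variable {B} in
theorem mem_spanFirstThree {x : F} :
    x ∈ spanFirstThree B ↔ B.repr x 3 = 0 ∧ B.repr x 4 = 0 := Iff.rfl

theorem spanFirstThree_eq_span : spanFirstThree B = Submodule.span k {B 0, B 1, B 2} := by
  apply le_antisymm
  · intro x hx
    obtain ⟨h3, h4⟩ := mem_spanFirstThree.1 hx
    rw [← B.sum_repr x, Fin.sum_univ_five, h3, h4, zero_smul, zero_smul, add_zero, add_zero]
    refine add_mem (add_mem ?_ ?_) ?_ <;>
      exact Submodule.smul_mem _ _ (Submodule.subset_span (by simp))
  · rw [Submodule.span_le]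
    rintro x (rfl | rfl | rfl) <;> simp [mem_spanFirstThree]

theorem finrank_spanFirstThree : finrank k (spanFirstThree B) = 3 := by
  have hli : LinearIndependent k (B ∘ ![0, 1, 2]) :=
    B.linearIndependent.comp _ (by decide)
  have hrange : Set.range (B ∘ ![0, 1, 2]) = {B 0, B 1, B 2} := by
    ext x
    simp [Fin.exists_fin_succ, eq_comm]
  rw [spanFirstThree_eq_span, ← hrange, finrank_span_eq_card hli, Fintype.card_fin]

theorem mem_spanFirstThree_of_pencil_apply_eq_zero {a b : k} (hab : a ≠ 0 ∨ b ≠ 0) {x : F}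
    (hx : (a • normalForm₁ B + b • normalForm₂ B) x = 0) : x ∈ spanFirstThree B := by
  have h0 := LinearMap.congr_fun hx (B 0)
  have h1 := LinearMap.congr_fun hx (B 1)
  have h2 := LinearMap.congr_fun hx (B 2)
  simp [normalForm₁_apply, normalForm₂_apply] at h0 h1 h2
  rw [mem_spanFirstThree]
  grind

theorem pencil_apply_eq_zero (a b : k) :
    (a • normalForm₁ B + b • normalForm₂ B)
      (a ^ 2 • B 0 + b ^ 2 • B 1 - (a * b) • B 2) = 0 := by
  ext y
  simp [normalForm₁_apply, normalForm₂_apply]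
  ring

theorem lSub_pencil_inf_lSub_pencil {a b c d : k} (h : a * d - b * c ≠ 0) :
    lSub (a • normalForm₁ B + b • normalForm₂ B) (c • normalForm₁ B + d • normalForm₂ B) ⊓
      lSub (c • normalForm₁ B + d • normalForm₂ B) (a • normalForm₁ B + b • normalForm₂ B) =
      spanFirstThree B := by
  have hab : a ≠ 0 ∨ b ≠ 0 := by grind
  have hcd : c ≠ 0 ∨ d ≠ 0 := by grind
  have isotropic {x y : F} (hx : x ∈ spanFirstThree B) (hy : y ∈ spanFirstThree B) (r s : k) :
      (r • normalForm₁ B + s • normalForm₂ B) x y = 0 := by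
    rw [mem_spanFirstThree] at hx hy
    simp [normalForm₁_apply, normalForm₂_apply, hx, hy]
  ext f
  rw [Submodule.mem_inf, mem_lSub, mem_lSub]
  constructor
  · rintro ⟨h1, h2⟩
    have e1 := h1 _ (pencil_apply_eq_zero B a b)
    have e2 := h2 _ (pencil_apply_eq_zero B c d)
    simp [normalForm₁_apply, normalForm₂_apply] at e1 e2
    have e1' : a * B.repr f 4 = b * B.repr f 3 :=
      mul_left_cancel₀ h (by linear_combination e1)
    have e2' : c * B.repr f 4 = d * B.repr f 3 :=
      mul_left_cancel₀ h (by linear_combination -e2)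
    exact mem_spanFirstThree.2
      ⟨(mul_eq_zero_iff_left h).1 (by linear_combination c * e1' - a * e2'),
        (mul_eq_zero_iff_left h).1 (by linear_combination d * e1' - b * e2')⟩
  · intro hf
    exact ⟨fun x hx => isotropic (mem_spanFirstThree_of_pencil_apply_eq_zero B hab hx) hf _ _,
      fun x hx => isotropic (mem_spanFirstThree_of_pencil_apply_eq_zero B hcd hx) hf _ _⟩

/-- The square-zero map sending `f₄` to `p f₁ + q f₂ + r f₃`, `f₅` to `s f₁ + r f₂ + p f₃` and
the other basis vectors to zero. -/
noncomputable def stabilizerNilpotent (p q r s : k) : F →ₗ[k] F :=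
  (B.coord 3).smulRight (p • B 0 + q • B 1 + r • B 2) +
    (B.coord 4).smulRight (s • B 0 + r • B 1 + p • B 2)

theorem stabilizerNilpotent_apply (p q r s : k) (x : F) :
    stabilizerNilpotent B p q r s x = B.repr x 3 • (p • B 0 + q • B 1 + r • B 2) +
      B.repr x 4 • (s • B 0 + r • B 1 + p • B 2) := rfl

theorem stabilizerNilpotent_comp_self (p q r s : k) (x : F) :
    stabilizerNilpotent B p q r s (stabilizerNilpotent B p q r s x) = 0 := by
  rw [stabilizerNilpotent_apply B p q r s (stabilizerNilpotent B p q r s x)]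
  simp [stabilizerNilpotent_apply]

/-- The unipotent automorphism `1 + N`, where `N` is `stabilizerNilpotent`. -/
noncomputable def stabilizerUnipotent (p q r s : k) : F ≃ₗ[k] F :=
  LinearEquiv.ofLinearMap (LinearMap.id + stabilizerNilpotent B p q r s)
    (LinearMap.id - stabilizerNilpotent B p q r s)
    (by ext x; simp [stabilizerNilpotent_comp_self])
    (by ext x; simp [stabilizerNilpotent_comp_self])

theorem stabilizerUnipotent_apply (p q r s : k) (x : F) :
    stabilizerUnipotent B p q r s x = x + stabilizerNilpotent B p q r s x := rfl

theorem stabilizerUnipotent_symm_apply (p q r s : k) (x : F) :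
    (stabilizerUnipotent B p q r s).symm x = x - stabilizerNilpotent B p q r s x := rfl

theorem actPair_stabilizerUnipotent (p q r s : k) :
    actPair 1 (stabilizerUnipotent B p q r s) (normalForm₁ B, normalForm₂ B) =
      (normalForm₁ B, normalForm₂ B) := by
  ext x y <;>
  · simp [actPair, stabilizerUnipotent_symm_apply, stabilizerNilpotent_apply,
      normalForm₁_apply, normalForm₂_apply]
    ring

theorem eq_spanFirstThree_of_stabilizerNilpotent_mem {W : Submodule k F}
    (hW : finrank k W = 3)
    (h : ∀ p q r s : k, ∀ x ∈ W, stabilizerNilpotent B p q r s x ∈ W) :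
    W = spanFirstThree B := by
  have : FiniteDimensional k F := B.finiteDimensional_of_finite
  by_cases hle : W ≤ spanFirstThree B
  · exact Submodule.eq_of_le_of_finrank_eq hle (by rw [hW, finrank_spanFirstThree])
  · refine (Submodule.eq_of_le_of_finrank_eq ?_ (by rw [hW, finrank_spanFirstThree])).symm
    obtain ⟨x, hxW, hx⟩ := SetLike.not_le_iff_exists.1 hle
    have h1 := h 1 0 0 0 x hxW
    have h2 := h 0 1 0 0 x hxW
    have h3 := h 0 0 1 0 x hxW
    have h4 := h 0 0 0 1 x hxW
    simp only [stabilizerNilpotent_apply, one_smul, zero_smul, add_zero, zero_add, smul_zero]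
      at h1 h2 h3 h4
    rw [spanFirstThree_eq_span, Submodule.span_le]
    by_cases hx3 : B.repr x 3 = 0
    · have hx4 : B.repr x 4 ≠ 0 := fun hx4 => hx (mem_spanFirstThree.2 ⟨hx3, hx4⟩)
      simp only [hx3, zero_smul, zero_add] at h1 h3
      rw [Submodule.smul_mem_iff _ hx4] at h1 h3 h4
      rintro y (rfl | rfl | rfl) <;> assumption
    · rw [Submodule.smul_mem_iff _ hx3] at h2
      rw [Submodule.add_mem_iff_left _ (W.smul_mem _ h2), Submodule.smul_mem_iff _ hx3] at h3
      rw [Submodule.add_mem_iff_left _ (W.smul_mem _ h3), Submodule.smul_mem_iff _ hx3] at h1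
      rintro y (rfl | rfl | rfl) <;> assumption

end NormalForm

/-- Let F be 5-dimensional with basis (f₁,…,f₅), let
ω₁ = f₂*∧f₄* + f₃*∧f₅*, ω₂ = f₁*∧f₅* + f₃*∧f₄*, and let O be the `GL₂(k) × GL(F)`-orbit of the
pair (ω₁,ω₂). If u equivariantly assigns to every p ∈ O a 3-dimensional subspace u(p) ⊆ F,
then u(p) = l(p₁,p₂) ∩ l(p₂,p₁) for all p = (p₁,p₂) ∈ O. -/
theorem equivariant_map_eq_U
    (k : Type*) [Field k]
    (F : Type*) [AddCommGroup F] [Module k F]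
    (B : Basis (Fin 5) k F)
    (ω₁ ω₂ : F →ₗ[k] F →ₗ[k] k)
    (hω₁ : ω₁ = wedge (B.coord 1) (B.coord 3) + wedge (B.coord 2) (B.coord 4))
    (hω₂ : ω₂ = wedge (B.coord 0) (B.coord 4) + wedge (B.coord 2) (B.coord 3))
    (O : Set ((F →ₗ[k] F →ₗ[k] k) × (F →ₗ[k] F →ₗ[k] k)))
    (hO : O = {p | ∃ (A : Matrix (Fin 2) (Fin 2) k) (g : F ≃ₗ[k] F),
      IsUnit A.det ∧ actPair A g (ω₁, ω₂) = p})
    (u : (F →ₗ[k] F →ₗ[k] k) × (F →ₗ[k] F →ₗ[k] k) → Submodule k F)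
    (hu3 : ∀ p ∈ O, finrank k (u p) = 3)
    (hequiv : ∀ (A : Matrix (Fin 2) (Fin 2) k) (g : F ≃ₗ[k] F), IsUnit A.det →
      ∀ p ∈ O, u (actPair A g p) = (u p).map g.toLinearMap) :
    ∀ p ∈ O, u p = lSub p.1 p.2 ⊓ lSub p.2 p.1 := by
  change ω₁ = normalForm₁ B at hω₁
  change ω₂ = normalForm₂ B at hω₂
  subst hω₁ hω₂ hO
  have hbase : (normalForm₁ B, normalForm₂ B) ∈
      {p | ∃ (A : Matrix (Fin 2) (Fin 2) k) (g : F ≃ₗ[k] F),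
        IsUnit A.det ∧ actPair A g (normalForm₁ B, normalForm₂ B) = p} :=
    ⟨1, stabilizerUnipotent B 0 0 0 0, by simp, actPair_stabilizerUnipotent B 0 0 0 0⟩
  have hu : u (normalForm₁ B, normalForm₂ B) = spanFirstThree B := by
    refine eq_spanFirstThree_of_stabilizerNilpotent_mem B (hu3 _ hbase) fun p q r s x hx => ?_
    have hinv := hequiv 1 (stabilizerUnipotent B p q r s) (by simp) _ hbase
    rw [actPair_stabilizerUnipotent] at hinv
    have hmem := Submodule.mem_map_of_mem (f := (stabilizerUnipotent B p q r s).toLinearMap) hx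
    rw [← hinv, LinearEquiv.coe_coe, stabilizerUnipotent_apply] at hmem
    exact (Submodule.add_mem_iff_right _ hx).1 hmem
  rintro _ ⟨A, g, hA, rfl⟩
  rw [hequiv A g hA _ hbase, hu]
  simp only [actPair, pullbackForm_smul_add_smul, lSub_pullbackForm]
  rw [← Submodule.map_inf _ g.injective, lSub_pencil_inf_lSub_pencil]
  rw [← Matrix.det_fin_two]
  exact hA.ne_zero
end
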